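/- arXiv:1611.07803 — 3 statements merged into one kernel-verified Lean document; each statement's English description precedes it below -/
import Mathlib

section
/- Soundness of the interpolant translation (Theorem 1). Let V be a finite type of propositional variables partitioned into a set X of input variables and a set Y of output variables. Let w be a word over V that is ultimately periodic with transient length m and period h ≥ 1, let u : ℕ be the unrolling degree, and set N = m + (u + 1) * h (positions 0, …, N − 1 are the states of the u-times-unrolled counterplay; positions m + u*h + j for j < h are the looping states, and positions m + r*h + j for r < u are the r-th unrolled replicas). Suppose that for every position n < N there are predicates BX_n on valuations depending only on X and BY_n depending only on Y such that BX_n (w n) and BY_n (w n) hold (the state components of a fully-separable interpolant implied by the counterplay translation). Define the successor function σ by σ(n) = n + 1 if n + 1 < N and σ(N − 1) = m + u*h. Then w satisfies the LTL translation of the interpolant, namely: (i) BX_0 (w 0) holds; (ii) for every n < N there exists t such that BX_n (w t) and BY_n (w t) and BX_{σ(n)} (w (t + 1)) all hold; and (iii) there exists T such that for every t ≥ T there exists j < h with BX_{m+u*h+j} (w t) and BY_{m+u*h+j} (w t) holding and, for every r < u, BX_{m+r*h+j} (w t) and BY_{m+r*h+j} (w t) holding. -/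
theorem eventually_periodic_add_mul {α : Type*} {w : ℕ → α} {m h : ℕ}
    (hper : ∀ n, m ≤ n → w (n + h) = w n) (r : ℕ) {n : ℕ} (hn : m ≤ n) :
    w (n + r * h) = w n := by
  induction r with
  | zero => simp
  | succ r ih =>
    rw [Nat.succ_mul, ← Nat.add_assoc, hper _ (hn.trans (Nat.le_add_right _ _)), ih]

/-- **Soundness of the interpolant translation (Theorem 1).**
`V` is a finite type of propositional variables partitioned into inputs `X` and outputs `Y`.
`w` is an ultimately periodic word (transient length `m`, period `h ≥ 1`), `u` is the
unrolling degree, `N = m + (u + 1) * h`.  For each position `n < N` the state components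
`BX n` (depending only on `X`) and `BY n` (depending only on `Y`) hold at `w n`.
`σ` is the successor function on the positions of the unrolled counterplay.
Then `w` satisfies the LTL translation of the fully-separable interpolant. -/
theorem interpolant_translation_soundness
    {V : Type*} [Fintype V] (X Y : Set V)
    (hpart : ∀ x : V, (x ∈ X ∨ x ∈ Y) ∧ ¬(x ∈ X ∧ x ∈ Y))
    (w : ℕ → V → Bool) (m h u : ℕ) (hh : 1 ≤ h)
    (hper : ∀ n, m ≤ n → w (n + h) = w n)
    (N : ℕ) (hN : N = m + (u + 1) * h)
    (BX BY : ℕ → (V → Bool) → Prop)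
    (hBXdep : ∀ n < N, ∀ v v' : V → Bool, (∀ x ∈ X, v x = v' x) → (BX n v ↔ BX n v'))
    (hBYdep : ∀ n < N, ∀ v v' : V → Bool, (∀ x ∈ Y, v x = v' x) → (BY n v ↔ BY n v'))
    (hBX : ∀ n < N, BX n (w n))
    (hBY : ∀ n < N, BY n (w n))
    (σ : ℕ → ℕ)
    (hσ : ∀ n, n + 1 < N → σ n = n + 1)
    (hσlast : σ (N - 1) = m + u * h) :
    BX 0 (w 0) ∧
    (∀ n < N, ∃ t, BX n (w t) ∧ BY n (w t) ∧ BX (σ n) (w (t + 1))) ∧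
    (∃ T, ∀ t ≥ T, ∃ j < h,
      (BX (m + u * h + j) (w t) ∧ BY (m + u * h + j) (w t)) ∧
      (∀ r < u, BX (m + r * h + j) (w t) ∧ BY (m + r * h + j) (w t))) := by
  have hlast : m + u * h + h = N := by rw [hN]; ring
  refine ⟨hBX 0 (by omega), fun n hn => ⟨n, hBX n hn, hBY n hn, ?_⟩, m, fun t ht => ?_⟩
  · by_cases hn' : n + 1 < N
    · rw [hσ n hn']
      exact hBX _ hn'
    · obtain rfl : n = N - 1 := by omega
      rw [hσlast, show N - 1 + 1 = m + u * h + h by omega,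
        hper _ (Nat.le_add_right _ _)]
      exact hBX _ (by omega)
  · have hj : (t - m) % h < h := Nat.mod_lt _ hh
    set j := (t - m) % h with hj_def
    have hwt : w t = w (m + j) := by
      have ht_eq : t = m + j + (t - m) / h * h := by
        have := Nat.mod_add_div' (t - m) h
        omega
      rw [← eventually_periodic_add_mul hper ((t - m) / h) (Nat.le_add_right m j), ← ht_eq]
    have hreplica : ∀ r ≤ u, BX (m + r * h + j) (w t) ∧ BY (m + r * h + j) (w t) := by
      intro r hr
      have hw : w t = w (m + r * h + j) := by
        rw [hwt, Nat.add_right_comm, eventually_periodic_add_mul hper r (Nat.le_add_right m j)]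
      have hlt : m + r * h + j < N := by
        have := Nat.mul_le_mul_right h hr
        omega
      rw [hw]
      exact ⟨hBX _ hlt, hBY _ hlt⟩
    exact ⟨j, hj, hreplica u le_rfl, fun r hr => hreplica r hr.le⟩
end

section
/- Each candidate GR(1) assumption obtained by negating the translated interpolant excludes the counterplay. Under the hypotheses of Theorem 1 — V finite and partitioned into inputs X and outputs Y; w a word that is ultimately periodic with transient length m and period h ≥ 1; u : ℕ; N = m + (u + 1) * h; for every n < N predicates BX_n depending only on X and BY_n depending only on Y with BX_n (w n) and BY_n (w n) holding; σ(n) = n + 1 for n + 1 < N and σ(N − 1) = m + u*h — the word w violates every disjunct of the negated translation: (i) w does not satisfy the initial-condition candidate ¬BX_0, i.e., BX_0 (w 0) holds; (ii) for every n < N, w does not satisfy the invariant candidate G ¬(BX_n ∧ BY_n ∧ X BX_{σ(n)}), i.e., it is not the case that for all t, ¬(BX_n (w t) ∧ BY_n (w t) ∧ BX_{σ(n)} (w (t + 1))); and (iii) w does not satisfy the fairness candidate GF ⋀_{j<h} ¬C_j, i.e., it is not the case that for every T there exists t ≥ T such that for all j < h, ¬C_j (w t), where C_j (v) abbreviates BX_{m+u*h+j}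 (v) ∧ BY_{m+u*h+j} (v) ∧ ⋀_{r<u} (BX_{m+r*h+j} (v) ∧ BY_{m+r*h+j} (v)). -/
/-- A word with transient length `m` and period `h` is unchanged when a position of its
periodic part is moved by a multiple of `h`. -/
theorem apply_add_mul_of_ultimately_periodic {α : Type*} {w : ℕ → α} {m h : ℕ}
    (hper : ∀ n, m ≤ n → w (n + h) = w n) (r j : ℕ) : w (m + r * h + j) = w (m + j) := by
  induction r with
  | zero => simp
  | succ r ih =>
    rw [← ih, ← hper (m + r * h + j) (by omega)]
    congr 1
    ring


/-- **Negated translated interpolant excludes the counterplay.**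
Under the hypotheses of Theorem 1, the counterplay `w` violates every disjunct of the
negated translation of the fully-separable interpolant: the initial-condition candidate,
every invariant candidate, and the fairness candidate. -/
theorem negated_interpolant_excludes_counterplay
    {V : Type*} [Fintype V] (X Y : Set V)
    (hpart : ∀ x : V, (x ∈ X ∨ x ∈ Y) ∧ ¬(x ∈ X ∧ x ∈ Y))
    (w : ℕ → V → Bool) (m h u : ℕ) (hh : 1 ≤ h)
    (hper : ∀ n, m ≤ n → w (n + h) = w n)
    (N : ℕ) (hN : N = m + (u + 1) * h)
    (BX BY : ℕ → (V → Bool) → Prop)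
    (hBXdep : ∀ n < N, ∀ v v' : V → Bool, (∀ x ∈ X, v x = v' x) → (BX n v ↔ BX n v'))
    (hBYdep : ∀ n < N, ∀ v v' : V → Bool, (∀ x ∈ Y, v x = v' x) → (BY n v ↔ BY n v'))
    (hBX : ∀ n < N, BX n (w n))
    (hBY : ∀ n < N, BY n (w n))
    (σ : ℕ → ℕ)
    (hσ : ∀ n, n + 1 < N → σ n = n + 1)
    (hσlast : σ (N - 1) = m + u * h)
    (C : ℕ → (V → Bool) → Prop)
    (hC : ∀ j, ∀ v : V → Bool, C j v ↔
      (BX (m + u * h + j) v ∧ BY (m + u * h + j) v ∧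
        ∀ r < u, BX (m + r * h + j) v ∧ BY (m + r * h + j) v)) :
    BX 0 (w 0) ∧
    (∀ n < N, ¬ (∀ t, ¬ (BX n (w t) ∧ BY n (w t) ∧ BX (σ n) (w (t + 1))))) ∧
    ¬ (∀ T, ∃ t ≥ T, ∀ j < h, ¬ C j (w t)) := by
  have hlt : ∀ r ≤ u, ∀ j < h, m + r * h + j < N := by
    intro r hr j hj
    have := Nat.mul_le_mul_right h hr
    rw [hN, Nat.succ_mul]
    omega
  have hNpos : 0 < N := (Nat.zero_le _).trans_lt (hlt 0 (Nat.zero_le u) 0 hh)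
  refine ⟨hBX 0 hNpos, fun n hn hinv => ?_, fun hfair => ?_⟩
  · refine hinv n ⟨hBX n hn, hBY n hn, ?_⟩
    by_cases hn' : n + 1 < N
    · rw [hσ n hn']
      exact hBX _ hn'
    · obtain rfl : n = N - 1 := by omega
      have hwrap : N - 1 + 1 = m + u * h + h := by
        rw [Nat.sub_add_cancel hNpos, hN]
        ring
      rw [hσlast, hwrap, hper _ (Nat.le_add_right _ _)]
      exact hBX _ (hlt u le_rfl 0 hh)
  · obtain ⟨t, ht, hviol⟩ := hfair m
    have hj : (t - m) % h < h := Nat.mod_lt _ hh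
    have hteq : t = m + (t - m) / h * h + (t - m) % h := by
      have := Nat.div_add_mod' (t - m) h
      omega
    have hwt : ∀ r, w t = w (m + r * h + (t - m) % h) := fun r => by
      rw [apply_add_mul_of_ultimately_periodic hper r,
        ← apply_add_mul_of_ultimately_periodic hper ((t - m) / h), ← hteq]
    have hblock : ∀ r ≤ u, BX (m + r * h + (t - m) % h) (w t) ∧
        BY (m + r * h + (t - m) % h) (w t) := fun r hr => by
      rw [hwt r]
      exact ⟨hBX _ (hlt r hr _ hj), hBY _ (hlt r hr _ hj)⟩
    exact hviol _ hj ((hC _ _).2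
      ⟨(hblock u le_rfl).1, (hblock u le_rfl).2, fun r hr => hblock r hr.le⟩)
end

section
/- Correctness of the Boolean translation of fairness conditions over a looping counterplay. Let w be a word over V that is ultimately periodic with transient length m and period h ≥ 1, and let P be a predicate on valuations. Then w satisfies the fairness condition GF P if and only if P holds at some looping state: (∀ N, ∃ n ≥ N, P (w n)) ↔ (∃ j < h, P (w (m + j))). -/
/-- A sequence with period `h` from position `m` on is invariant under shifts by multiples of `h`
from `m` on. -/
theorem apply_add_mul_of_eventually_periodic {α : Type*} {w : ℕ → α} {m h : ℕ}
    (hper : ∀ n, m ≤ n → w (n + h) = w n) {n : ℕ} (hn : m ≤ n) (k : ℕ) :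
    w (n + h * k) = w n := by
  induction k with
  | zero => simp
  | succ k ih => rw [Nat.mul_succ, ← Nat.add_assoc, hper _ (by omega), ih]

/-- **Correctness of the Boolean translation of fairness conditions over a looping
counterplay.**  A fairness condition `GF P` holds on an ultimately periodic word iff `P`
holds at some looping state. -/
theorem fairness_translation_correct
    {V : Type*} [Fintype V]
    (w : ℕ → V → Bool) (m h : ℕ) (hh : 1 ≤ h)
    (hper : ∀ n, m ≤ n → w (n + h) = w n)
    (P : (V → Bool) → Prop) :
    (∀ N, ∃ n ≥ N, P (w n)) ↔ (∃ j < h, P (w (m + j))) := by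
  constructor
  · intro hP
    obtain ⟨n, hn, hPn⟩ := hP m
    refine ⟨(n - m) % h, Nat.mod_lt _ hh, ?_⟩
    rw [← apply_add_mul_of_eventually_periodic hper (Nat.le_add_right m _) ((n - m) / h),
      Nat.add_assoc, Nat.mod_add_div, Nat.add_sub_cancel' hn]
    exact hPn
  · rintro ⟨j, -, hPj⟩ N
    refine ⟨m + j + h * N, (Nat.le_mul_of_pos_left N hh).trans (Nat.le_add_left _ _), ?_⟩
    rwa [apply_add_mul_of_eventually_periodic hper (Nat.le_add_right m j)]
end
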